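/- arXiv:2308.13827 — 9 statements merged into one kernel-verified Lean document; each statement's English description precedes it below -/
import Mathlib

section
/- Let P be a uniformly valid p-value and let 0 ≤ λ < τ ≤ 1 and 0 ≤ a ≤ τ be real numbers. Then ℙ(P ≤ a) + (a/(τ − λ))·ℙ(P ≤ λ) ≤ (a/(τ − λ))·ℙ(P ≤ τ). -/
open MeasureTheory

/-- A p-value `P` is uniformly valid w.r.t. `Pr` if
`Pr(P ≤ x·y) ≤ x·Pr(P ≤ y)` for all `x, y ∈ [0,1]`. -/
def UniformlyValid {Ω : Type*} [MeasurableSpace Ω] (Pr : Measure Ω) (P : Ω → ℝ) : Prop :=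
  ∀ x ∈ Set.Icc (0 : ℝ) 1, ∀ y ∈ Set.Icc (0 : ℝ) 1,
    Pr {ω | P ω ≤ x * y} ≤ ENNReal.ofReal x * Pr {ω | P ω ≤ y}

/-- For a uniformly valid p-value `P` and reals `0 ≤ λ < τ ≤ 1`, `0 ≤ a ≤ τ`:
`Pr(P ≤ a) + (a/(τ − λ))·Pr(P ≤ λ) ≤ (a/(τ − λ))·Pr(P ≤ τ)`. -/
theorem uniformlyValid_discard_ineq
    {Ω : Type*} [MeasurableSpace Ω] (Pr : Measure Ω) [IsProbabilityMeasure Pr]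
    (P : Ω → ℝ) (hPmeas : Measurable P) (hPrange : ∀ ω, P ω ∈ Set.Icc (0 : ℝ) 1)
    (hP : UniformlyValid Pr P)
    (lam τ a : ℝ) (hlam : 0 ≤ lam) (hlt : lam < τ) (hτ : τ ≤ 1)
    (ha0 : 0 ≤ a) (ha : a ≤ τ) :
    Pr {ω | P ω ≤ a} + ENNReal.ofReal (a / (τ - lam)) * Pr {ω | P ω ≤ lam} ≤
      ENNReal.ofReal (a / (τ - lam)) * Pr {ω | P ω ≤ τ} := by
  have hτ0 : 0 < τ := hlam.trans_lt hlt
  have hd : 0 < τ - lam := sub_pos.2 hlt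
  have scaled (c : ℝ) (hc0 : 0 ≤ c) (hc : c ≤ τ) :
      Pr {ω | P ω ≤ c} ≤ ENNReal.ofReal (c / τ) * Pr {ω | P ω ≤ τ} := by
    have h := hP (c / τ) ⟨by positivity, (div_le_one hτ0).2 hc⟩ τ ⟨hτ0.le, hτ⟩
    rwa [div_mul_cancel₀ c hτ0.ne'] at h
  calc
    _ ≤ ENNReal.ofReal (a / τ) * Pr {ω | P ω ≤ τ} + ENNReal.ofReal (a / (τ - lam)) *
          (ENNReal.ofReal (lam / τ) * Pr {ω | P ω ≤ τ}) := by
      gcongr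
      · exact scaled a ha0 ha
      · exact scaled lam hlam hlt.le
    _ = ENNReal.ofReal (a / (τ - lam)) * Pr {ω | P ω ≤ τ} := by
      rw [← mul_assoc, ← add_mul, ← ENNReal.ofReal_mul (by positivity),
        ← ENNReal.ofReal_add (by positivity) (by positivity)]
      congr 2
      field_simp
      ring
end

section
/- Let P₁ and P₂ be independent p-values with P₁ uniformly distributed on [0,1] and P₂ valid. Let α ∈ (0,1) and constants α₁, λ₁ with 0 ≤ α₁ ≤ λ₁ < 1 and α − α₁(1 − α)/(1 − λ₁) ≥ 0. Define the random level α₂ = α on the event {P₁ ≤ λ₁} and α₂ = α − α₁(1 − α)/(1 − λ₁) on the event {P₁ > λ₁}. Then ℙ(P₁ ≤ α₁ or P₂ ≤ α₂) ≤ α, with equality if P₂ is uniformly distributed on [0,1]. -/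
open MeasureTheory ProbabilityTheory

/-- The rejection probability of a two-step procedure which rejects when `X ≤ a`, or when `Y ≤ b` on
`{X ≤ l}`, or when `Y ≤ c` on `{X > l}`, for independent `X` and `Y`. -/
theorem measureReal_two_step_rejection {Ω : Type*} [MeasurableSpace Ω] {μ : Measure Ω}
    [IsProbabilityMeasure μ] {X Y : Ω → ℝ} (hX : Measurable X) (hY : Measurable Y)
    (hXY : IndepFun X Y μ) {a l : ℝ} (hal : a ≤ l) (b c : ℝ) :
    μ.real {ω | X ω ≤ a ∨ Y ω ≤ if X ω ≤ l then b else c} =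
      μ.real {ω | X ω ≤ a} +
        (μ.real {ω | X ω ≤ l} - μ.real {ω | X ω ≤ a}) * μ.real {ω | Y ω ≤ b} +
        (1 - μ.real {ω | X ω ≤ l}) * μ.real {ω | Y ω ≤ c} := by
  have hevent : {ω | X ω ≤ a ∨ Y ω ≤ if X ω ≤ l then b else c} =
      (X ⁻¹' Set.Iic a ∪ X ⁻¹' Set.Ioc a l ∩ Y ⁻¹' Set.Iic b) ∪
        X ⁻¹' Set.Ioi l ∩ Y ⁻¹' Set.Iic c := by
    ext ω
    simp only [Set.mem_ofPred_eq, Set.mem_union, Set.mem_inter_iff, Set.mem_preimage,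
      Set.mem_Iic, Set.mem_Ioc, Set.mem_Ioi]
    split_ifs <;> grind
  have hmul {s t : Set ℝ} (hs : MeasurableSet s) (ht : MeasurableSet t) :
      μ.real (X ⁻¹' s ∩ Y ⁻¹' t) = μ.real (X ⁻¹' s) * μ.real (Y ⁻¹' t) := by
    simp only [measureReal_def, hXY.measure_inter_preimage_eq_mul s t hs ht, ENNReal.toReal_mul]
  have hIoc : μ.real (X ⁻¹' Set.Ioc a l) = μ.real (X ⁻¹' Set.Iic l) - μ.real (X ⁻¹' Set.Iic a) := by
    rw [← Set.Iic_sdiff_Iic, Set.preimage_sdiff]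
    exact measureReal_sdiff (Set.preimage_mono (Set.Iic_subset_Iic.2 hal)) (hX measurableSet_Iic)
  have hIoi : μ.real (X ⁻¹' Set.Ioi l) = 1 - μ.real (X ⁻¹' Set.Iic l) := by
    rw [← Set.compl_Iic, Set.preimage_compl]
    exact probReal_compl_eq_one_sub (hX measurableSet_Iic)
  rw [hevent, measureReal_union _ ((hX measurableSet_Ioi).inter (hY measurableSet_Iic)),
    measureReal_union _ ((hX measurableSet_Ioc).inter (hY measurableSet_Iic)),
    hmul measurableSet_Ioc measurableSet_Iic, hmul measurableSet_Ioi measurableSet_Iic, hIoc, hIoi]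
  · rfl
  · rw [Set.disjoint_left]
    rintro ω h ⟨⟨h', -⟩, -⟩
    exact not_lt_of_ge h h'
  · rw [Set.disjoint_left]
    rintro ω (h | ⟨⟨-, h⟩, -⟩) ⟨h', -⟩
    · exact not_lt_of_ge (h.trans hal) h'
    · exact not_lt_of_ge h h'

/-- **Two-step exhaustive ADDIS calculation.** Let `P₁, P₂` be independent p-values
with `P₁` uniformly distributed on `[0,1]` and `P₂` valid. For constants
`0 ≤ α₁ ≤ l₁ < 1` with `α − α₁(1 − α)/(1 − l₁) ≥ 0`, define the random level
`α₂ = α` on `{P₁ ≤ l₁}` and `α₂ = α − α₁(1 − α)/(1 − l₁)` on `{P₁ > l₁}`. Then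
`Pr(P₁ ≤ α₁ or P₂ ≤ α₂) ≤ α`, with equality if `P₂` is uniformly distributed. -/
theorem two_step_exhaustive_ADDIS
    {Ω : Type*} [MeasurableSpace Ω] (Pr : Measure Ω) [IsProbabilityMeasure Pr]
    (P₁ P₂ : Ω → ℝ) (h1meas : Measurable P₁) (h2meas : Measurable P₂)
    (h1range : ∀ ω, P₁ ω ∈ Set.Icc (0 : ℝ) 1) (h2range : ∀ ω, P₂ ω ∈ Set.Icc (0 : ℝ) 1)
    (hindep : IndepFun P₁ P₂ Pr)
    (h1unif : ∀ x ∈ Set.Icc (0 : ℝ) 1, Pr {ω | P₁ ω ≤ x} = ENNReal.ofReal x)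
    (h2valid : ∀ x ∈ Set.Icc (0 : ℝ) 1, Pr {ω | P₂ ω ≤ x} ≤ ENNReal.ofReal x)
    (α α₁ l₁ : ℝ) (hα : α ∈ Set.Ioo (0 : ℝ) 1)
    (hα₁0 : 0 ≤ α₁) (hα₁l : α₁ ≤ l₁) (hl : l₁ < 1)
    (hpos : 0 ≤ α - α₁ * (1 - α) / (1 - l₁))
    (α₂ : Ω → ℝ)
    (hα₂ : ∀ ω, α₂ ω = if P₁ ω ≤ l₁ then α else α - α₁ * (1 - α) / (1 - l₁)) :
    Pr {ω | P₁ ω ≤ α₁ ∨ P₂ ω ≤ α₂ ω} ≤ ENNReal.ofReal α ∧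
      ((∀ x ∈ Set.Icc (0 : ℝ) 1, Pr {ω | P₂ ω ≤ x} = ENNReal.ofReal x) →
        Pr {ω | P₁ ω ≤ α₁ ∨ P₂ ω ≤ α₂ ω} = ENNReal.ofReal α) := by
  obtain ⟨hα0, hα1⟩ := hα
  have hl' : 0 < 1 - l₁ := sub_pos.2 hl
  have hshift : 0 ≤ α₁ * (1 - α) / (1 - l₁) := by
    have := sub_pos.2 hα1
    positivity
  have hbudget : (1 - l₁) * (α - α₁ * (1 - α) / (1 - l₁)) = (1 - l₁) * α - α₁ * (1 - α) := by
    field_simp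
  have hαmem : α ∈ Set.Icc (0 : ℝ) 1 := ⟨hα0.le, hα1.le⟩
  have hβmem : α - α₁ * (1 - α) / (1 - l₁) ∈ Set.Icc (0 : ℝ) 1 := ⟨hpos, by linarith⟩
  have hunif {x : ℝ} (hx : x ∈ Set.Icc (0 : ℝ) 1) : Pr.real {ω | P₁ ω ≤ x} = x := by
    rw [measureReal_def, h1unif x hx, ENNReal.toReal_ofReal hx.1]
  have hprob := measureReal_two_step_rejection h1meas h2meas hindep hα₁l α
    (α - α₁ * (1 - α) / (1 - l₁))
  simp only [← hα₂] at hprob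
  rw [hunif ⟨hα₁0, by linarith⟩, hunif ⟨by linarith, hl.le⟩] at hprob
  constructor
  · have hvalid {x : ℝ} (hx : x ∈ Set.Icc (0 : ℝ) 1) : Pr.real {ω | P₂ ω ≤ x} ≤ x :=
      ENNReal.toReal_le_of_le_ofReal hx.1 (h2valid x hx)
    rw [← ofReal_measureReal]
    apply ENNReal.ofReal_le_ofReal
    have hbelow := mul_le_mul_of_nonneg_left (hvalid hαmem) (sub_nonneg.2 hα₁l)
    have habove := mul_le_mul_of_nonneg_left (hvalid hβmem) hl'.le
    linarith
  · intro h2unif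
    have hunif₂ {x : ℝ} (hx : x ∈ Set.Icc (0 : ℝ) 1) : Pr.real {ω | P₂ ω ≤ x} = x := by
      rw [measureReal_def, h2unif x hx, ENNReal.toReal_ofReal hx.1]
    rw [hunif₂ hαmem, hunif₂ hβmem] at hprob
    rw [← ofReal_measureReal]
    congr 1
    linarith
end

section
/- For the Exhaustive-ADDIS-Spending procedure the remaining level has the closed form α^(i) = α·(1 − ∑_{k < t(i)} γ_k) for all i, and the defining condition of the exhaustive ADDIS algorithm holds at every step: α^(i) − α_i(1 − α^(i))/(τ_i − λ_i) ≥ 0 (in particular 0 ≤ α^(i) ≤ α < 1 for all i). -/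
/-- **Closed form of the remaining level for Exhaustive-ADDIS-Spending.**
With `tᵢ = ∑_{j<i}(sⱼ − cⱼ)` counting the non-discarded, non-adapted hypotheses,
the remaining level satisfies `α⁽ⁱ⁾ = α·(1 − ∑_{k < tᵢ} γₖ)` for all `i`, and the
defining condition of the exhaustive ADDIS algorithm
`α⁽ⁱ⁾ − αᵢ(1 − α⁽ⁱ⁾)/(τᵢ − λᵢ) ≥ 0` holds at every step; in particular
`0 ≤ α⁽ⁱ⁾ ≤ α < 1`. -/
theorem exhaustiveADDIS_spending_closed_form
    (α : ℝ) (hα : α ∈ Set.Ioo (0 : ℝ) 1)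
    (γ : ℕ → ℝ) (hγ : ∀ k, 0 ≤ γ k)
    (hγsum : ∀ n, ∑ k ∈ Finset.range n, γ k ≤ 1)
    (τ lam : ℕ → ℝ) (hτ : ∀ i, 0 < τ i ∧ τ i ≤ 1)
    (hlam : ∀ i, 0 ≤ lam i ∧ lam i < τ i)
    (s c : ℕ → ℕ) (hs : ∀ i, s i ≤ 1) (hcs : ∀ i, c i ≤ s i)
    (t : ℕ → ℕ) (ht : ∀ i, t i = ∑ j ∈ Finset.range i, (s j - c j))
    (level alev : ℕ → ℝ)
    (hlevel0 : level 0 = α)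
    (halev : ∀ i, alev i = (τ i - lam i) / (1 - level i) * (α * γ (t i)))
    (hlevelsucc : ∀ i, level (i + 1) =
      level i - alev i * (1 - level i) / (τ i - lam i) * ((s i : ℝ) - (c i : ℝ))) :
    ∀ i, level i = α * (1 - ∑ k ∈ Finset.range (t i), γ k) ∧
      0 ≤ level i ∧ level i ≤ α ∧
      0 ≤ level i - alev i * (1 - level i) / (τ i - lam i) := by
  have le_alpha (n : ℕ) : α * (1 - ∑ k ∈ Finset.range n, γ k) ≤ α :=
    mul_le_of_le_one_right hα.1.le (sub_le_self _ (Finset.sum_nonneg fun k _ => hγ k))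
  have nonneg (n : ℕ) : 0 ≤ α * (1 - ∑ k ∈ Finset.range n, γ k) :=
    mul_nonneg hα.1.le (sub_nonneg.2 (hγsum n))
  have spent (i : ℕ) (h : level i = α * (1 - ∑ k ∈ Finset.range (t i), γ k)) :
      alev i * (1 - level i) / (τ i - lam i) = α * γ (t i) := by
    have h₁ : 1 - level i ≠ 0 := by
      have := le_alpha (t i)
      have := hα.2
      exact ne_of_gt (by linarith)
    have h₂ : τ i - lam i ≠ 0 := (sub_pos.2 (hlam i).2).ne'
    rw [halev]
    field_simp
  have closed (i : ℕ) : level i = α * (1 - ∑ k ∈ Finset.range (t i), γ k) := by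
    induction i with
    | zero => simp [ht, hlevel0]
    | succ i ih =>
      have htsucc : t (i + 1) = t i + (s i - c i) := by
        rw [ht, ht, Finset.sum_range_succ]
      rw [hlevelsucc, spent i ih, ih, htsucc, ← Nat.cast_sub (hcs i)]
      obtain h | h : s i - c i = 0 ∨ s i - c i = 1 := by have := hs i; omega
      · simp [h]
      · rw [h, Finset.sum_range_succ]
        push_cast
        ring
  intro i
  refine ⟨closed i, closed i ▸ nonneg _, closed i ▸ le_alpha _, ?_⟩
  have h := nonneg (t i + 1)
  rw [Finset.sum_range_succ] at h
  rw [spent i (closed i), closed i]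
  linarith
end

section
/- For the Exhaustive-ADDIS-Graph procedure, the spent level never exceeds the budget: for every i, ∑_{j<i} b_j(s_j − c_j) + b_i ≤ α, where b_j = α_j(1 − α^(j))/(τ_j − λ_j). Consequently α^(i) ≥ 0 for all i and the defining condition of the exhaustive ADDIS algorithm, α^(i) − α_i(1 − α^(i))/(τ_i − λ_i) ≥ 0, holds at every step. -/
/-- A nonnegative budget `a`, split by weights with partial sums at most `1` and passed along a
graph whose outgoing weights sum to at most `1`, is never overspent when node `j` forwards only
the fraction `d j` of what it receives. -/
theorem graph_budget_le {a : ℝ} (ha : 0 ≤ a) {γ : ℕ → ℝ}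
    (hγsum : ∀ n, ∑ i ∈ Finset.range n, γ i ≤ 1) {g : ℕ → ℕ → ℝ}
    (hgsum : ∀ j n, ∑ i ∈ Finset.Ioc j n, g j i ≤ 1) {d b : ℕ → ℝ}
    (hd : ∀ i, 0 ≤ d i) (hb_nonneg : ∀ i, 0 ≤ b i)
    (hb : ∀ i, b i = a * γ i + ∑ j ∈ Finset.range i, g j i * d j * b j) (i : ℕ) :
    ∑ j ∈ Finset.range i, b j * (1 - d j) + b i ≤ a := by
  have hswap : ∑ k ∈ Finset.range (i + 1), ∑ j ∈ Finset.range k, g j k * d j * b j =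
      ∑ j ∈ Finset.range i, ∑ k ∈ Finset.Ioc j i, g j k * d j * b j := by
    refine Finset.sum_comm' fun k j => ?_
    simp only [Finset.mem_range, Finset.mem_Ioc]
    omega
  have hforward : ∑ j ∈ Finset.range i, ∑ k ∈ Finset.Ioc j i, g j k * d j * b j ≤
      ∑ j ∈ Finset.range i, d j * b j := by
    refine Finset.sum_le_sum fun j _ => ?_
    simp_rw [mul_assoc, ← Finset.sum_mul]
    exact mul_le_of_le_one_left (mul_nonneg (hd j) (hb_nonneg j)) (hgsum j i)
  have htotal : ∑ k ∈ Finset.range (i + 1), b k =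
      a * ∑ k ∈ Finset.range (i + 1), γ k +
        ∑ k ∈ Finset.range (i + 1), ∑ j ∈ Finset.range k, g j k * d j * b j := by
    rw [Finset.mul_sum, ← Finset.sum_add_distrib]
    exact Finset.sum_congr rfl fun k _ => hb k
  have hinit := mul_le_of_le_one_right ha (hγsum (i + 1))
  have hsplit : ∑ j ∈ Finset.range i, b j * (1 - d j) =
      ∑ j ∈ Finset.range i, b j - ∑ j ∈ Finset.range i, d j * b j := by
    rw [← Finset.sum_sub_distrib]
    exact Finset.sum_congr rfl fun j _ => by ring
  rw [Finset.sum_range_succ] at htotal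
  linarith


/-- **The Exhaustive-ADDIS-Graph never overspends its budget.** With
`bⱼ = αⱼ(1 − α⁽ʲ⁾)/(τⱼ − λⱼ)` the spent levels, for every `i` one has
`∑_{j<i} bⱼ(sⱼ − cⱼ) + bᵢ ≤ α`; consequently `α⁽ⁱ⁾ ≥ 0` and the defining condition
of the exhaustive ADDIS algorithm `α⁽ⁱ⁾ − αᵢ(1 − α⁽ⁱ⁾)/(τᵢ − λᵢ) ≥ 0` holds at
every step. -/
theorem exhaustiveADDIS_graph_budget
    (α : ℝ) (hα : α ∈ Set.Ioo (0 : ℝ) 1)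
    (γ : ℕ → ℝ) (hγ : ∀ i, 0 ≤ γ i)
    (hγsum : ∀ n, ∑ i ∈ Finset.range n, γ i ≤ 1)
    (g : ℕ → ℕ → ℝ) (hg : ∀ j i, 0 ≤ g j i)
    (hgsum : ∀ j n, ∑ i ∈ Finset.Ioc j n, g j i ≤ 1)
    (τ lam : ℕ → ℝ) (hτ : ∀ i, 0 < τ i ∧ τ i ≤ 1)
    (hlam : ∀ i, 0 ≤ lam i ∧ lam i < τ i)
    (s c : ℕ → ℝ) (hs : ∀ i, s i = 0 ∨ s i = 1) (hc : ∀ i, c i = 0 ∨ c i = 1)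
    (hcs : ∀ i, c i ≤ s i)
    (b level alev : ℕ → ℝ)
    (hb : ∀ i, b i = α * γ i + ∑ j ∈ Finset.range i, g j i * (c j - s j + 1) * b j)
    (hlevel0 : level 0 = α)
    (hlevelsucc : ∀ i, level (i + 1) = level i - b i * (s i - c i))
    (halev : ∀ i, alev i = (τ i - lam i) / (1 - level i) *
      (α * γ i + ∑ j ∈ Finset.range i, g j i * (c j - s j + 1) * b j)) :
    ∀ i, (∑ j ∈ Finset.range i, b j * (s j - c j)) + b i ≤ α ∧
      0 ≤ level i ∧
      0 ≤ level i - alev i * (1 - level i) / (τ i - lam i) := by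
  have hd (j : ℕ) : 0 ≤ c j - s j + 1 := by
    rcases hs j with h | h <;> rcases hc j with h' | h' <;> rw [h, h'] <;> norm_num
  have hb_nonneg (i : ℕ) : 0 ≤ b i := by
    induction i using Nat.strong_induction_on with
    | _ i ih =>
      rw [hb i]
      refine add_nonneg (mul_nonneg hα.1.le (hγ i)) (Finset.sum_nonneg fun j hj => ?_)
      exact mul_nonneg (mul_nonneg (hg j i) (hd j)) (ih j (Finset.mem_range.mp hj))
  have hlevel (i : ℕ) : level i = α - ∑ j ∈ Finset.range i, b j * (s j - c j) := by
    induction i with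
    | zero => simp [hlevel0]
    | succ i ih => rw [hlevelsucc, ih, Finset.sum_range_succ]; ring
  intro i
  have hbudget : ∑ j ∈ Finset.range i, b j * (s j - c j) + b i ≤ α := by
    have h := graph_budget_le hα.1.le hγsum hgsum hd hb_nonneg hb i
    have hfrac (j : ℕ) : 1 - (c j - s j + 1) = s j - c j := by ring
    simpa only [hfrac] using h
  have hspent : 0 ≤ ∑ j ∈ Finset.range i, b j * (s j - c j) :=
    Finset.sum_nonneg fun j _ => mul_nonneg (hb_nonneg j) (sub_nonneg.mpr (hcs j))
  have hcond : alev i * (1 - level i) / (τ i - lam i) = b i := by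
    have hgap : τ i - lam i ≠ 0 := (sub_pos.mpr (hlam i).2).ne'
    have hrem : 1 - level i ≠ 0 := by
      refine (sub_pos.mpr ?_).ne'
      rw [hlevel]
      linarith [hα.2]
    rw [halev, ← hb]
    field_simp
  rw [hcond]
  have := hb_nonneg i
  have := hlevel i
  exact ⟨hbudget, by linarith, by linarith⟩
end

section
/- The Exhaustive-ADDIS-Graph uniformly improves the ADDIS-Graph: with the same parameters (γ, g, τ, λ) and the same indicator sequences (s_i), (c_i), the individual levels satisfy α_i^E = α_i^{AG}/(1 − α^(i)) ≥ α_i^{AG} for every i, where α_i^{AG} is the ADDIS-Graph level and α_i^E the Exhaustive-ADDIS-Graph level. -/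
/-- Normalised by nonzero weights, the levels of a weighted graph recursion satisfy the
unweighted recursion, and hence agree with its solution. -/
theorem eq_mul_of_weighted_recursion {a b w u : ℕ → ℝ} {k : ℕ → ℕ → ℝ} (hw : ∀ i, w i ≠ 0)
    (ha : ∀ i, a i = w i * (u i + ∑ j ∈ Finset.range i, k j i * (a j / w j)))
    (hb : ∀ i, b i = u i + ∑ j ∈ Finset.range i, k j i * b j) (i : ℕ) :
    a i = w i * b i := by
  induction i using Nat.strong_induction_on with
  | _ i ih =>
    rw [ha, hb]
    congr 2
    refine Finset.sum_congr rfl fun j hj => ?_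
    rw [ih j (Finset.mem_range.mp hj), mul_div_cancel_left₀ _ (hw j)]

/-- The solution of a graph recursion with nonnegative data is nonnegative. -/
theorem nonneg_of_recursion {b u : ℕ → ℝ} {k : ℕ → ℕ → ℝ} (hu : ∀ i, 0 ≤ u i)
    (hk : ∀ j i, 0 ≤ k j i)
    (hb : ∀ i, b i = u i + ∑ j ∈ Finset.range i, k j i * b j) (i : ℕ) : 0 ≤ b i := by
  induction i using Nat.strong_induction_on with
  | _ i ih =>
    rw [hb]
    exact add_nonneg (hu i) (Finset.sum_nonneg fun j hj =>
      mul_nonneg (hk j i) (ih j (Finset.mem_range.mp hj)))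

/-- **The Exhaustive-ADDIS-Graph uniformly improves the ADDIS-Graph.** With the
same parameters `(γ, g, τ, λ)` and the same indicator sequences `(sᵢ), (cᵢ)`, the
individual levels satisfy `αᵢᴱ = αᵢᴬᴳ/(1 − α⁽ⁱ⁾) ≥ αᵢᴬᴳ` for every `i`. -/
theorem exhaustiveADDIS_graph_uniform_improvement
    (α : ℝ) (hα : α ∈ Set.Ioo (0 : ℝ) 1)
    (γ : ℕ → ℝ) (hγ : ∀ i, 0 ≤ γ i)
    (hγsum : ∀ n, ∑ i ∈ Finset.range n, γ i ≤ 1)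
    (g : ℕ → ℕ → ℝ) (hg : ∀ j i, 0 ≤ g j i)
    (hgsum : ∀ j n, ∑ i ∈ Finset.Ioc j n, g j i ≤ 1)
    (τ lam : ℕ → ℝ) (hτ : ∀ i, 0 < τ i ∧ τ i ≤ 1)
    (hlam : ∀ i, 0 ≤ lam i ∧ lam i < τ i)
    (s c : ℕ → ℝ) (hs : ∀ i, s i = 0 ∨ s i = 1) (hc : ∀ i, c i = 0 ∨ c i = 1)
    (hcs : ∀ i, c i ≤ s i)
    -- the ADDIS-Graph levels
    (aAG : ℕ → ℝ)
    (hAG : ∀ i, aAG i = (τ i - lam i) *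
      (α * γ i + ∑ j ∈ Finset.range i, g j i * (c j - s j + 1) * (aAG j / (τ j - lam j))))
    -- the Exhaustive-ADDIS-Graph
    (b level aE : ℕ → ℝ)
    (hb : ∀ i, b i = α * γ i + ∑ j ∈ Finset.range i, g j i * (c j - s j + 1) * b j)
    (hlevel0 : level 0 = α)
    (hlevelsucc : ∀ i, level (i + 1) = level i - b i * (s i - c i))
    (hlevel_range : ∀ i, 0 ≤ level i ∧ level i ≤ α)
    (haE : ∀ i, aE i = (τ i - lam i) / (1 - level i) *
      (α * γ i + ∑ j ∈ Finset.range i, g j i * (c j - s j + 1) * b j)) :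
    ∀ i, aE i = aAG i / (1 - level i) ∧ aAG i ≤ aE i := by
  have hw : ∀ i, 0 < τ i - lam i := fun i => sub_pos.mpr (hlam i).2
  have hk : ∀ j i, 0 ≤ g j i * (c j - s j + 1) := fun j i => by
    refine mul_nonneg (hg j i) ?_
    rcases hs j with h | h <;> rcases hc j with h' | h' <;> norm_num [h, h']
  have hbnonneg := nonneg_of_recursion (fun i => mul_nonneg hα.1.le (hγ i)) hk hb
  have hab := eq_mul_of_weighted_recursion (fun i => (hw i).ne') hAG hb
  intro i
  have hE : aE i = aAG i / (1 - level i) := by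
    rw [haE, ← hb, hab, div_mul_eq_mul_div]
  refine ⟨hE, ?_⟩
  rw [hE]
  have hlevel := hlevel_range i
  have hpos : 0 < 1 - level i := by linarith [hα.2]
  have haAG : 0 ≤ aAG i := hab i ▸ mul_nonneg (hw i).le (hbnonneg i)
  exact le_div_self haAG hpos (by linarith)
end

section
/- The Evenly-Improved-ADDIS-Graph satisfies the exhaustive ADDIS condition at level α: for every i, ∑_{j≤i} (1 − α^(j))·d_j·(s_j − c_j) ≤ α, where d_j = α_j/(τ_j − λ_j) is its normalized individual level; in particular α^(i) ≥ 0 for all i. -/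
/-- Conservation of mass: if each node `j < n` passes on at most a fraction `u j` of the mass it
receives, then the mass retained by the nodes is at most the mass injected. -/
theorem sum_range_one_sub_mul_le_of_flow {n : ℕ} {a d u : ℕ → ℝ} {w : ℕ → ℕ → ℝ}
    (hd : ∀ i < n, d i = a i + ∑ j ∈ Finset.range i, w j i * d j)
    (hd_nonneg : ∀ j < n, 0 ≤ d j)
    (hw : ∀ j < n, ∑ i ∈ Finset.Ico (j + 1) n, w j i ≤ u j) :
    ∑ j ∈ Finset.range n, (1 - u j) * d j ≤ ∑ j ∈ Finset.range n, a j := by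
  have hswap : ∑ i ∈ Finset.range n, ∑ j ∈ Finset.range i, w j i * d j =
      ∑ j ∈ Finset.range n, (∑ i ∈ Finset.Ico (j + 1) n, w j i) * d j := by
    simp only [Finset.range_eq_Ico, Finset.sum_mul]
    exact (Finset.sum_Ico_Ico_comm' 0 n fun j i => w j i * d j).symm
  have htotal : ∑ i ∈ Finset.range n, d i =
      ∑ i ∈ Finset.range n, a i + ∑ i ∈ Finset.range n, ∑ j ∈ Finset.range i, w j i * d j := by
    rw [← Finset.sum_add_distrib]
    exact Finset.sum_congr rfl fun i hi => hd i (Finset.mem_range.mp hi)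
  have hpassed : ∑ j ∈ Finset.range n, (∑ i ∈ Finset.Ico (j + 1) n, w j i) * d j ≤
      ∑ j ∈ Finset.range n, u j * d j := by
    refine Finset.sum_le_sum fun j hj => ?_
    rw [Finset.mem_range] at hj
    exact mul_le_mul_of_nonneg_right (hw j hj) (hd_nonneg j hj)
  simp only [sub_mul, one_mul, Finset.sum_sub_distrib]
  linarith

/-- **The Evenly-Improved-ADDIS-Graph satisfies the exhaustive ADDIS condition at
level `α`**: for every `i`, `∑_{j ≤ i} (1 − α⁽ʲ⁾)·dⱼ·(sⱼ − cⱼ) ≤ α`, where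
`dⱼ = αⱼ/(τⱼ − λⱼ)` is its normalized individual level; in particular `α⁽ⁱ⁾ ≥ 0`
for all `i`. -/
theorem evenlyImprovedADDIS_graph_condition
    (α : ℝ) (hα : α ∈ Set.Ioo (0 : ℝ) 1)
    (γ : ℕ → ℝ) (hγ : ∀ i, 0 ≤ γ i)
    (hγsum : ∀ n, ∑ i ∈ Finset.range n, γ i ≤ 1)
    (g h : ℕ → ℕ → ℝ) (hg : ∀ j i, 0 ≤ g j i) (hh : ∀ j i, 0 ≤ h j i)
    (hgsum : ∀ j n, ∑ i ∈ Finset.Ioc j n, g j i ≤ 1)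
    (hhsum : ∀ j n, ∑ i ∈ Finset.Ioc j n, h j i ≤ 1)
    (τ lam : ℕ → ℝ) (hτ : ∀ i, 0 < τ i ∧ τ i ≤ 1)
    (hlam : ∀ i, 0 ≤ lam i ∧ lam i < τ i)
    (s c : ℕ → ℝ) (hs : ∀ i, s i = 0 ∨ s i = 1) (hc : ∀ i, c i = 0 ∨ c i = 1)
    (hcs : ∀ i, c i ≤ s i)
    (d level alev : ℕ → ℝ)
    (hlevel : ∀ i, level i =
      α - ∑ j ∈ Finset.range i, (1 - level j) * d j * (s j - c j))
    (hd : ∀ i, d i = α * γ i + ∑ j ∈ Finset.range i, g j i * (c j - s j + 1) * d j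
      + ∑ j ∈ Finset.range i, h j i * (s j - c j) * level j * d j)
    (halev : ∀ i, alev i = (τ i - lam i) * d i) :
    ∀ i, (∑ j ∈ Finset.range (i + 1), (1 - level j) * d j * (s j - c j)) ≤ α ∧
      0 ≤ level i := by
  have hx_nonneg : ∀ j, 0 ≤ s j - c j := fun j => sub_nonneg.mpr (hcs j)
  have hx_compl_nonneg : ∀ j, 0 ≤ c j - s j + 1 := by
    intro j
    rcases hs j with hsj | hsj <;> rcases hc j with hcj | hcj <;> linarith
  have hIco : ∀ (f : ℕ → ℕ → ℝ), (∀ j i, 0 ≤ f j i) →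
      (∀ j n, ∑ i ∈ Finset.Ioc j n, f j i ≤ 1) →
      ∀ j n, ∑ i ∈ Finset.Ico (j + 1) n, f j i ≤ 1 := by
    intro f hf hfsum j n
    refine le_trans (Finset.sum_le_sum_of_subset_of_nonneg ?_ fun i _ _ => hf j i) (hfsum j n)
    intro i hi
    simp only [Finset.mem_Ico, Finset.mem_Ioc] at hi ⊢
    omega
  have hspent : ∀ n, (∀ j < n, 0 ≤ d j ∧ 0 ≤ level j) →
      ∑ j ∈ Finset.range n, (1 - level j) * d j * (s j - c j) ≤ α := by
    intro n hn
    have hflow := sum_range_one_sub_mul_le_of_flow (n := n) (a := fun i => α * γ i) (d := d)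
      (u := fun j => (c j - s j + 1) + (s j - c j) * level j)
      (w := fun j i => g j i * (c j - s j + 1) + h j i * ((s j - c j) * level j))
      (fun i _ => by
        rw [hd i, add_assoc, ← Finset.sum_add_distrib]
        congr 1
        exact Finset.sum_congr rfl fun j _ => by ring)
      (fun j hj => (hn j hj).1)
      (fun j hj => by
        rw [Finset.sum_add_distrib, ← Finset.sum_mul, ← Finset.sum_mul]
        exact add_le_add
          (mul_le_of_le_one_left (hx_compl_nonneg j) (hIco g hg hgsum j n))
          (mul_le_of_le_one_left (mul_nonneg (hx_nonneg j) (hn j hj).2) (hIco h hh hhsum j n)))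
    calc ∑ j ∈ Finset.range n, (1 - level j) * d j * (s j - c j)
        = ∑ j ∈ Finset.range n, (1 - ((c j - s j + 1) + (s j - c j) * level j)) * d j :=
          Finset.sum_congr rfl fun j _ => by ring
      _ ≤ ∑ j ∈ Finset.range n, α * γ j := hflow
      _ = α * ∑ j ∈ Finset.range n, γ j := (Finset.mul_sum _ _ _).symm
      _ ≤ α := mul_le_of_le_one_right hα.1.le (hγsum n)
  have hnonneg : ∀ n, 0 ≤ d n ∧ 0 ≤ level n := by
    intro n
    induction n using Nat.strong_induction_on with
    | _ n ih =>
      refine ⟨?_, by rw [hlevel n]; exact sub_nonneg.mpr (hspent n ih)⟩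
      rw [hd n]
      refine add_nonneg (add_nonneg (mul_nonneg hα.1.le (hγ n)) ?_) ?_
      · exact Finset.sum_nonneg fun j hj => mul_nonneg
          (mul_nonneg (hg j n) (hx_compl_nonneg j)) (ih j (Finset.mem_range.mp hj)).1
      · refine Finset.sum_nonneg fun j hj => ?_
        obtain ⟨hdj, hlj⟩ := ih j (Finset.mem_range.mp hj)
        exact mul_nonneg (mul_nonneg (mul_nonneg (hh j n) (hx_nonneg j)) hlj) hdj
  exact fun i => ⟨hspent (i + 1) fun j _ => hnonneg j, (hnonneg i).2⟩
end

section
/- The Evenly-Improved-ADDIS-Graph uniformly improves the ADDIS-Graph: with the same parameters (γ, g, τ, λ) and the same indicator sequences (s_i), (c_i), and assuming α^(j) ≥ 0 for all j, the individual levels satisfy α_i^{EI} ≥ α_i^{AG} for every i. -/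
/-- **The Evenly-Improved-ADDIS-Graph uniformly improves the ADDIS-Graph.** With
the same parameters `(γ, g, τ, λ)` and the same indicator sequences `(sᵢ), (cᵢ)`,
and assuming `α⁽ʲ⁾ ≥ 0` for all `j`, the individual levels satisfy
`αᵢᴱᴵ ≥ αᵢᴬᴳ` for every `i`. -/
theorem evenlyImprovedADDIS_graph_uniform_improvement
    (α : ℝ) (hα : α ∈ Set.Ioo (0 : ℝ) 1)
    (γ : ℕ → ℝ) (hγ : ∀ i, 0 ≤ γ i)
    (hγsum : ∀ n, ∑ i ∈ Finset.range n, γ i ≤ 1)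
    (g h : ℕ → ℕ → ℝ) (hg : ∀ j i, 0 ≤ g j i) (hh : ∀ j i, 0 ≤ h j i)
    (hgsum : ∀ j n, ∑ i ∈ Finset.Ioc j n, g j i ≤ 1)
    (hhsum : ∀ j n, ∑ i ∈ Finset.Ioc j n, h j i ≤ 1)
    (τ lam : ℕ → ℝ) (hτ : ∀ i, 0 < τ i ∧ τ i ≤ 1)
    (hlam : ∀ i, 0 ≤ lam i ∧ lam i < τ i)
    (s c : ℕ → ℝ) (hs : ∀ i, s i = 0 ∨ s i = 1) (hc : ∀ i, c i = 0 ∨ c i = 1)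
    (hcs : ∀ i, c i ≤ s i)
    -- the ADDIS-Graph levels
    (aAG : ℕ → ℝ)
    (hAG : ∀ i, aAG i = (τ i - lam i) *
      (α * γ i + ∑ j ∈ Finset.range i, g j i * (c j - s j + 1) * (aAG j / (τ j - lam j))))
    -- the Evenly-Improved-ADDIS-Graph
    (d level aEI : ℕ → ℝ)
    (hlevel : ∀ i, level i =
      α - ∑ j ∈ Finset.range i, (1 - level j) * d j * (s j - c j))
    (hlevel_nonneg : ∀ j, 0 ≤ level j)
    (hd : ∀ i, d i = α * γ i + ∑ j ∈ Finset.range i, g j i * (c j - s j + 1) * d j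
      + ∑ j ∈ Finset.range i, h j i * (s j - c j) * level j * d j)
    (haEI : ∀ i, aEI i = (τ i - lam i) * d i) :
    ∀ i, aAG i ≤ aEI i := by
  have hτlam : ∀ i, 0 < τ i - lam i := fun i ↦ sub_pos.2 (hlam i).2
  have hkeep : ∀ j, 0 ≤ c j - s j + 1 := fun j ↦ by
    rcases hs j with h₁ | h₁ <;> rcases hc j with h₂ | h₂ <;> norm_num [h₁, h₂]
  have hd_nonneg : ∀ i, 0 ≤ d i := fun i ↦ by
    induction i using Nat.strong_induction_on with
    | _ i ih =>
      rw [hd i]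
      refine add_nonneg (add_nonneg (mul_nonneg hα.1.le (hγ i)) ?_) ?_
      · exact Finset.sum_nonneg fun j hj ↦
          mul_nonneg (mul_nonneg (hg j i) (hkeep j)) (ih j (Finset.mem_range.1 hj))
      · exact Finset.sum_nonneg fun j hj ↦
          mul_nonneg (mul_nonneg (mul_nonneg (hh j i) (sub_nonneg.2 (hcs j)))
            (hlevel_nonneg j)) (ih j (Finset.mem_range.1 hj))
  have hle : ∀ i, aAG i / (τ i - lam i) ≤ d i := fun i ↦ by
    induction i using Nat.strong_induction_on with
    | _ i ih =>
      rw [hAG i, mul_div_cancel_left₀ _ (hτlam i).ne', hd i]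
      have hrecycled : 0 ≤ ∑ j ∈ Finset.range i, h j i * (s j - c j) * level j * d j :=
        Finset.sum_nonneg fun j _ ↦
          mul_nonneg (mul_nonneg (mul_nonneg (hh j i) (sub_nonneg.2 (hcs j)))
            (hlevel_nonneg j)) (hd_nonneg j)
      refine le_add_of_le_of_nonneg (add_le_add_right (Finset.sum_le_sum fun j hj ↦ ?_) _)
        hrecycled
      exact mul_le_mul_of_nonneg_left (ih j (Finset.mem_range.1 hj))
        (mul_nonneg (hg j i) (hkeep j))
  intro i
  rw [haEI i, mul_comm]
  exact (div_le_iff₀ (hτlam i)).1 (hle i)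
end

section
/- Restricting the exhaustive ADDIS level recursion to a subset of indices can only increase the remaining level: let α ∈ (0,1), let (q_i)_{i≥1} be nonnegative reals and (d_i)_{i≥1} be {0,1}-valued, and let I₀ ⊆ ℕ. Define A_1 = α, A_{i+1} = A_i − q_i(1 − A_i)d_i, and B_1 = α, B_{i+1} = B_i − q_i(1 − B_i)d_i·𝟙{i ∈ I₀}. If A_i ≥ 0 for all i, then B_i ≥ A_i ≥ 0 for all i; in particular B_i − q_i(1 − B_i)d_i·𝟙{i ∈ I₀} ≥ 0 for all i. -/
/-- **Restricting the exhaustive ADDIS level recursion to a subset of indices can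
only increase the remaining level.** Let `A₀ = B₀ = α`,
`A_{i+1} = A_i − qᵢ(1 − A_i)dᵢ` and `B_{i+1} = B_i − qᵢ(1 − B_i)dᵢ·𝟙{i ∈ I₀}`.
If `Aᵢ ≥ 0` for all `i`, then `Bᵢ ≥ Aᵢ ≥ 0` for all `i`; in particular
`Bᵢ − qᵢ(1 − Bᵢ)dᵢ·𝟙{i ∈ I₀} ≥ 0` for all `i`. -/
theorem exhaustiveADDIS_level_subset_mono
    (α : ℝ) (hα : α ∈ Set.Ioo (0 : ℝ) 1)
    (q : ℕ → ℝ) (hq : ∀ i, 0 ≤ q i)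
    (d : ℕ → ℝ) (hd : ∀ i, d i = 0 ∨ d i = 1)
    (I₀ : Set ℕ)
    (A B : ℕ → ℝ)
    (hA0 : A 0 = α) (hB0 : B 0 = α)
    (hAsucc : ∀ i, A (i + 1) = A i - q i * (1 - A i) * d i)
    (hBsucc : ∀ i, B (i + 1) =
      B i - q i * (1 - B i) * d i * Set.indicator I₀ (fun _ => (1 : ℝ)) i)
    (hAnonneg : ∀ i, 0 ≤ A i) :
    ∀ i, (A i ≤ B i ∧ 0 ≤ B i) ∧
      0 ≤ B i - q i * (1 - B i) * d i * Set.indicator I₀ (fun _ => (1 : ℝ)) i := by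
  have hqd : ∀ i, 0 ≤ q i * d i := fun i =>
    mul_nonneg (hq i) (by rcases hd i with h | h <;> simp [h])
  have hA_le_one : ∀ i, A i ≤ 1 := by
    intro i
    induction i with
    | zero => exact hA0 ▸ hα.2.le
    | succ i ih =>
      rw [hAsucc]
      nlinarith [mul_nonneg (hqd i) (sub_nonneg.2 ih)]
  have hAB : ∀ i, A i ≤ B i := by
    intro i
    induction i with
    | zero => rw [hA0, hB0]
    | succ i ih =>
      rw [hAsucc, hBsucc]
      by_cases hi : i ∈ I₀
      · rw [Set.indicator_of_mem hi]
        nlinarith [mul_nonneg (hqd i) (sub_nonneg.2 ih)]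
      · rw [Set.indicator_of_notMem hi]
        nlinarith [mul_nonneg (hqd i) (sub_nonneg.2 (hA_le_one i))]
  have hB_nonneg : ∀ i, 0 ≤ B i := fun i => (hAnonneg i).trans (hAB i)
  exact fun i => ⟨⟨hAB i, hB_nonneg i⟩, hBsucc i ▸ hB_nonneg (i + 1)⟩
end

section
/- The graphical recursion for the ADDIS-Graph produces its closed-form levels: define v_0(i) = α·γ_i for all i, and for k ≥ 1 set v_k(i) = v_{k−1}(i) + e_k·g_{k,i}·v_{k−1}(k) for i > k and v_k(i) = v_{k−1}(i) for i ≤ k. Then for every i ≥ 1, v_{i−1}(i) = ã_i, where ã_i is defined by the closed-form recursion ã_i = α·γ_i + ∑_{j<i} g_{j,i}·e_j·ã_j. -/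
/-- Unrolling the graphical update: up to time `i`, the weight of `i` is its initial weight plus
the contributions received from the hypotheses processed so far. -/
theorem graph_weight_eq_sum {R : Type*} [CommSemiring R] {g v : ℕ → ℕ → R} {e : ℕ → R}
    (hvsucc : ∀ k i, v (k + 1) i = if k < i then v k i + e k * g k i * v k k else v k i)
    {k i : ℕ} (hki : k ≤ i) :
    v k i = v 0 i + ∑ j ∈ Finset.range k, g j i * e j * v j j := by
  induction k with
  | zero => simp
  | succ k ih =>
    rw [hvsucc, if_pos (Nat.lt_of_succ_le hki), ih (Nat.le_of_succ_le hki), Finset.sum_range_succ]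
    ring

/-- **The graphical recursion of the ADDIS-Graph produces its closed-form levels.**
Start with `v 0 i = α·γᵢ`; after processing hypothesis `k` (with indicator
`eₖ = 𝟙{Pₖ ≤ λₖ or Pₖ > τₖ}`), update `v (k+1) i = v k i + eₖ·g_{k,i}·v k k` for
`i > k` and leave `v (k+1) i = v k i` otherwise. Then the level assigned to
hypothesis `i` at the time of its test equals the closed-form ADDIS-Graph level:
`v i i = ãᵢ`, where `ãᵢ = α·γᵢ + ∑_{j<i} g_{j,i}·eⱼ·ãⱼ`. -/
theorem ADDIS_graph_graphical_representation
    (α : ℝ) (hα : α ∈ Set.Ioo (0 : ℝ) 1)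
    (γ : ℕ → ℝ) (hγ : ∀ i, 0 ≤ γ i)
    (g : ℕ → ℕ → ℝ) (hg : ∀ j i, 0 ≤ g j i)
    (e : ℕ → ℝ) (he : ∀ j, e j = 0 ∨ e j = 1)
    (v : ℕ → ℕ → ℝ)
    (hv0 : ∀ i, v 0 i = α * γ i)
    (hvsucc : ∀ k i, v (k + 1) i = if k < i then v k i + e k * g k i * v k k else v k i)
    (ta : ℕ → ℝ)
    (hta : ∀ i, ta i = α * γ i + ∑ j ∈ Finset.range i, g j i * e j * ta j) :
    ∀ i, v i i = ta i := by
  intro i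
  induction i using Nat.strong_induction_on with
  | _ i ih =>
    rw [graph_weight_eq_sum hvsucc le_rfl, hv0, hta]
    congr 1
    refine Finset.sum_congr rfl fun j hj => ?_
    rw [ih j (Finset.mem_range.mp hj)]
end
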